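/- There exist a constant c > 0 and n₀ such that for all n ≥ n₀, f₂(n, C₆) ≥ c·n^{4/3}, where C₆ is the cycle of length 6. -/

import Mathlib

open Finset

/-- `c` is a proper edge colouring of the complete graph on `Fin n`:
it is symmetric and edges sharing a vertex receive distinct colours. -/
def IsProperEdgeColoring (n : ℕ) (c : Fin n → Fin n → ℕ) : Prop :=
  (∀ a b, c a b = c b a) ∧
    ∀ a b b', a ≠ b → a ≠ b' → b ≠ b' → c a b ≠ c a b'

/-- The number of colours used by `c` on the edges of the complete graph on `Fin n`. -/
def numColors (n : ℕ) (c : Fin n → Fin n → ℕ) : ℕ :=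
  ((Finset.univ.filter fun p : Fin n × Fin n => p.1 ≠ p.2).image fun p => c p.1 p.2).card

/-- The edge colouring `c` of the complete graph on `Fin n` contains `k` pairwise
vertex-disjoint, pairwise colour-isomorphic copies of `H`. -/
def HasRepeat (n k : ℕ) {V : Type*} (H : SimpleGraph V) (c : Fin n → Fin n → ℕ) : Prop :=
  ∃ φ : Fin k → V → Fin n,
    (∀ i, Function.Injective (φ i)) ∧
    (∀ i j, i ≠ j → ∀ u v, φ i u ≠ φ j v) ∧
    (∀ i j, ∀ u v, H.Adj u v → c (φ i u) (φ i v) = c (φ j u) (φ j v))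

/-- `repeatNumber k n H` is `f_k(n,H)`: the smallest number of colours `C` such that there
is a proper edge colouring of `K_n` with `C` colours containing no `k` pairwise
vertex-disjoint, pairwise colour-isomorphic copies of `H`. -/
noncomputable def repeatNumber (k n : ℕ) {V : Type*} (H : SimpleGraph V) : ℕ :=
  sInf { C | ∃ c : Fin n → Fin n → ℕ,
    IsProperEdgeColoring n c ∧ numColors n c = C ∧ ¬ HasRepeat n k H c }

section WeightedWalks

variable {V : Type*}

/-- The weight of the closed walk `a b c d e k`. -/
def hexWeight (f : V → V → ℝ) (a b c d e k : V) : ℝ :=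
  f a b * f b c * f c d * f d e * f e k * f k a

lemma hexWeight_rotate (f : V → V → ℝ) (a b c d e k : V) :
    hexWeight f b c d e k a = hexWeight f a b c d e k := by
  unfold hexWeight; ring

variable [Fintype V]

/-- Cyclic rotation of the variables of a six-fold sum. -/
lemma sum_rotate_six (g : V → V → V → V → V → V → ℝ) :
    ∑ a, ∑ b, ∑ c, ∑ d, ∑ e, ∑ k, g b c d e k a =
      ∑ a, ∑ b, ∑ c, ∑ d, ∑ e, ∑ k, g a b c d e k := by
  rw [Finset.sum_comm]
  refine Finset.sum_congr rfl fun b _ => ?_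
  rw [Finset.sum_comm]
  refine Finset.sum_congr rfl fun c _ => ?_
  rw [Finset.sum_comm]
  refine Finset.sum_congr rfl fun d _ => ?_
  rw [Finset.sum_comm]
  refine Finset.sum_congr rfl fun e _ => ?_
  rw [Finset.sum_comm]

/-- The weight of the walks of length two from `u` to `v`. -/
def walkTwo (f : V → V → ℝ) (u v : V) : ℝ := ∑ y, f u y * f y v

lemma walkTwo_symm {f : V → V → ℝ} (hf : ∀ u v, f u v = f v u) (u v : V) :
    walkTwo f u v = walkTwo f v u :=
  Finset.sum_congr rfl fun y _ => by rw [hf u y, hf y v, mul_comm]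

/-- Closed walks of length six whose first and third vertices are related. -/
lemma sum_hexWeight_dist_two_le {f A r : V → V → ℝ} {s D : ℝ} (hs0 : 0 ≤ s)
    (hf : ∀ u v, f u v = f v u) (hA : ∀ u v, A u v = A v u) (hr : ∀ u v, r u v = r v u)
    (hA0 : ∀ u v, 0 ≤ A u v) (hr0 : ∀ u v, 0 ≤ r u v)
    (hfA : ∀ u v, f u v * A u v = f u v)
    (hs : ∀ u v, ∑ w, A v w * r u w ≤ s) (hD : ∀ u, ∑ v, f u v ^ 2 ≤ D) :
    ∑ a, ∑ b, ∑ c, ∑ d, ∑ e, ∑ k, r a c * hexWeight f a b c d e k ≤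
      s * D * ∑ u, ∑ v, walkTwo f u v ^ 2 := by
  set P := walkTwo f with hP
  have hone : ∑ a, ∑ e, ∑ b, ∑ c, f a b ^ 2 * P a e ^ 2 * (A b c * r a c) ≤
      s * D * ∑ u, ∑ v, P u v ^ 2 := by
    rw [Finset.mul_sum]
    refine Finset.sum_le_sum fun a _ => ?_
    rw [Finset.mul_sum]
    refine Finset.sum_le_sum fun e _ => ?_
    calc ∑ b, ∑ c, f a b ^ 2 * P a e ^ 2 * (A b c * r a c)
        ≤ ∑ b, f a b ^ 2 * P a e ^ 2 * s := by
          refine Finset.sum_le_sum fun b _ => ?_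
          rw [← Finset.mul_sum]
          exact mul_le_mul_of_nonneg_left (hs a b) (by positivity)
      _ = (∑ b, f a b ^ 2) * (s * P a e ^ 2) := by
          rw [Finset.sum_mul]
          exact Finset.sum_congr rfl fun b _ => by ring
      _ ≤ D * (s * P a e ^ 2) := mul_le_mul_of_nonneg_right (hD a) (by positivity)
      _ = s * D * P a e ^ 2 := by ring
  have hcollapse : ∀ a b c, ∑ d, ∑ e, ∑ k, r a c * hexWeight f a b c d e k =
      ∑ e, r a c * (f a b * f b c * P c e * P e a) := by
    intro a b c
    rw [Finset.sum_comm]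
    refine Finset.sum_congr rfl fun e _ => ?_
    simp only [hP, walkTwo, hexWeight, Finset.mul_sum, Finset.sum_mul]
    rw [Finset.sum_comm]
    exact Finset.sum_congr rfl fun d _ => Finset.sum_congr rfl fun k _ => by ring
  simp only [hcollapse]
  have hterm : ∀ a b c e, r a c * (f a b * f b c * P c e * P e a) ≤
      (f a b ^ 2 * P a e ^ 2 * (A b c * r a c)) / 2 +
        (f c b ^ 2 * P c e ^ 2 * (A b a * r c a)) / 2 := by
    intro a b c e
    have h1 : f a b * A b a = f a b := by rw [hA b a, hfA]
    have h2 : f c b * A b c = f c b := by rw [hA b c, hfA]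
    have h3 : f a b ^ 2 * A b a = f a b ^ 2 := by rw [pow_two, mul_assoc, h1]
    have h4 : f c b ^ 2 * A b c = f c b ^ 2 := by rw [pow_two, mul_assoc, h2]
    rw [hf b c, hP, walkTwo_symm hf e a, ← hP, hr c a]
    have := mul_nonneg (mul_nonneg (mul_nonneg (hr0 a c) (hA0 b a)) (hA0 b c))
      (sq_nonneg (f a b * P a e - f c b * P c e))
    calc r a c * (f a b * f c b * P c e * P a e)
        = r a c * ((f a b * A b a) * (f c b * A b c) * P c e * P a e) := by rw [h1, h2]
      _ ≤ ((f a b ^ 2 * A b a) * P a e ^ 2 * (A b c * r a c)) / 2 +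
        ((f c b ^ 2 * A b c) * P c e ^ 2 * (A b a * r a c)) / 2 := by nlinarith
      _ = _ := by rw [h3, h4]
  have hfirst : ∑ a, ∑ b, ∑ c, ∑ e, f a b ^ 2 * P a e ^ 2 * (A b c * r a c) =
      ∑ a, ∑ e, ∑ b, ∑ c, f a b ^ 2 * P a e ^ 2 * (A b c * r a c) := by
    refine Finset.sum_congr rfl fun a _ => ?_
    conv_rhs => rw [Finset.sum_comm]
    exact Finset.sum_congr rfl fun b _ => Finset.sum_comm
  have hsecond : ∑ a, ∑ b, ∑ c, ∑ e, f c b ^ 2 * P c e ^ 2 * (A b a * r c a) =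
      ∑ a, ∑ b, ∑ c, ∑ e, f a b ^ 2 * P a e ^ 2 * (A b c * r a c) := by
    rw [Finset.sum_comm]
    conv_rhs => rw [Finset.sum_comm]
    exact Finset.sum_congr rfl fun b _ => Finset.sum_comm
  calc ∑ a, ∑ b, ∑ c, ∑ e, r a c * (f a b * f b c * P c e * P e a)
      ≤ ∑ a, ∑ b, ∑ c, ∑ e, ((f a b ^ 2 * P a e ^ 2 * (A b c * r a c)) / 2 +
        (f c b ^ 2 * P c e ^ 2 * (A b a * r c a)) / 2) := by
        gcongr with a _ b _ c _ e _
        exact hterm a b c e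
    _ = (∑ a, ∑ b, ∑ c, ∑ e, f a b ^ 2 * P a e ^ 2 * (A b c * r a c)) / 2 +
        (∑ a, ∑ b, ∑ c, ∑ e, f c b ^ 2 * P c e ^ 2 * (A b a * r c a)) / 2 := by
        simp only [Finset.sum_add_distrib, Finset.sum_div]
    _ ≤ _ := by rw [hsecond, hfirst]; linarith

/-- Closed walks of length six whose first and fourth vertices are related. -/
lemma sum_hexWeight_antipodal_le {f A r : V → V → ℝ} {s D : ℝ}
    (hD0 : 0 ≤ D) (hf : ∀ u v, f u v = f v u) (hf0 : ∀ u v, 0 ≤ f u v)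
    (hr0 : ∀ u v, 0 ≤ r u v)
    (hs : ∀ u v, ∑ w, A v w * r u w ≤ s) (hD : ∀ u v, f u v * ∑ w, f v w ≤ A u v * D) :
    ∑ a, ∑ b, ∑ c, ∑ d, ∑ e, ∑ k, r a d * hexWeight f a b c d e k ≤
      s * D * ∑ u, ∑ v, walkTwo f u v ^ 2 := by
  set P := walkTwo f with hP
  have hone : ∑ a, ∑ c, ∑ d, ∑ e, P a c ^ 2 * (r a d * (f c d * f d e)) ≤
      s * D * ∑ u, ∑ v, P u v ^ 2 := by
    rw [Finset.mul_sum]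
    refine Finset.sum_le_sum fun a _ => ?_
    rw [Finset.mul_sum]
    refine Finset.sum_le_sum fun c _ => ?_
    calc ∑ d, ∑ e, P a c ^ 2 * (r a d * (f c d * f d e))
        = P a c ^ 2 * ∑ d, r a d * (f c d * ∑ e, f d e) := by simp only [Finset.mul_sum]
      _ ≤ P a c ^ 2 * ∑ d, r a d * (A c d * D) := by
          refine mul_le_mul_of_nonneg_left (Finset.sum_le_sum fun d _ => ?_) (sq_nonneg _)
          exact mul_le_mul_of_nonneg_left (hD c d) (hr0 a d)
      _ = P a c ^ 2 * (D * ∑ d, A c d * r a d) := by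
          rw [Finset.mul_sum (a := D)]
          congr 1
          exact Finset.sum_congr rfl fun d _ => by ring
      _ ≤ P a c ^ 2 * (D * s) := by
          gcongr
          exact hs a c
      _ = s * D * P a c ^ 2 := by ring
  have hcollapse : ∀ a, ∑ b, ∑ c, ∑ d, ∑ e, ∑ k, r a d * hexWeight f a b c d e k =
      ∑ c, ∑ d, ∑ e, r a d * (f c d * f d e) * (P a c * P a e) := by
    intro a
    rw [Finset.sum_comm]
    refine Finset.sum_congr rfl fun c _ => ?_
    rw [Finset.sum_comm]
    refine Finset.sum_congr rfl fun d _ => ?_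
    rw [Finset.sum_comm]
    refine Finset.sum_congr rfl fun e _ => ?_
    rw [hP, walkTwo_symm hf a e]
    simp only [walkTwo, hexWeight, Finset.mul_sum, Finset.sum_mul]
    rw [Finset.sum_comm]
    exact Finset.sum_congr rfl fun b _ => Finset.sum_congr rfl fun k _ => by ring
  simp only [hcollapse]
  have hsecond : ∑ a, ∑ c, ∑ d, ∑ e, P a e ^ 2 * (r a d * (f e d * f d c)) =
      ∑ a, ∑ c, ∑ d, ∑ e, P a c ^ 2 * (r a d * (f c d * f d e)) := by
    refine Finset.sum_congr rfl fun a _ => ?_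
    rw [Finset.sum_comm]
    conv_rhs => rw [Finset.sum_comm]
    exact Finset.sum_congr rfl fun d _ => Finset.sum_comm
  calc ∑ a, ∑ c, ∑ d, ∑ e, r a d * (f c d * f d e) * (P a c * P a e)
      ≤ ∑ a, ∑ c, ∑ d, ∑ e, ((P a c ^ 2 * (r a d * (f c d * f d e))) / 2 +
        (P a e ^ 2 * (r a d * (f e d * f d c))) / 2) := by
        gcongr with a _ c _ d _ e _
        rw [hf e d, hf d c]
        have := mul_nonneg (mul_nonneg (hr0 a d) (mul_nonneg (hf0 c d) (hf0 d e)))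
          (sq_nonneg (P a c - P a e))
        nlinarith
    _ = (∑ a, ∑ c, ∑ d, ∑ e, P a c ^ 2 * (r a d * (f c d * f d e))) / 2 +
        (∑ a, ∑ c, ∑ d, ∑ e, P a e ^ 2 * (r a d * (f e d * f d c))) / 2 := by
        simp only [Finset.sum_add_distrib, Finset.sum_div]
    _ ≤ _ := by rw [hsecond]; linarith

/-- If every closed walk of length six has a related pair at distance two or three, then the
total weight of these walks is controlled by the one of the closed walks of length four. -/
lemma sum_hexWeight_le {f A r : V → V → ℝ} {s D : ℝ} (hs0 : 0 ≤ s) (hD0 : 0 ≤ D)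
    (hf : ∀ u v, f u v = f v u) (hA : ∀ u v, A u v = A v u) (hr : ∀ u v, r u v = r v u)
    (hf0 : ∀ u v, 0 ≤ f u v) (hA0 : ∀ u v, 0 ≤ A u v) (hr0 : ∀ u v, 0 ≤ r u v)
    (hfA : ∀ u v, f u v * A u v = f u v)
    (hs : ∀ u v, ∑ w, A v w * r u w ≤ s) (hD : ∀ u, ∑ v, f u v ^ 2 ≤ D)
    (hD' : ∀ u v, f u v * ∑ w, f v w ≤ A u v * D)
    (hbad : ∀ a b c d e k, hexWeight f a b c d e k ≠ 0 →
      1 ≤ r a c + r b d + r c e + r d k + r e a + r k b + r a d + r b e + r c k) :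
    ∑ a, ∑ b, ∑ c, ∑ d, ∑ e, ∑ k, hexWeight f a b c d e k ≤
      9 * (s * D) * ∑ u, ∑ v, walkTwo f u v ^ 2 := by
  have h2 := sum_hexWeight_dist_two_le hs0 hf hA hr hA0 hr0 hfA hs hD
  have h3 := sum_hexWeight_antipodal_le hD0 hf hf0 hr0 hs hD'
  let g2 : V → V → V → V → V → V → ℝ := fun a b c d e k => r a c * hexWeight f a b c d e k
  let g3 : V → V → V → V → V → V → ℝ := fun a b c d e k => r a d * hexWeight f a b c d e k
  have r1 := sum_rotate_six g2
  have r2 := sum_rotate_six fun a b c d e k => g2 b c d e k a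
  have r3 := sum_rotate_six fun a b c d e k => g2 c d e k a b
  have r4 := sum_rotate_six fun a b c d e k => g2 d e k a b c
  have r5 := sum_rotate_six fun a b c d e k => g2 e k a b c d
  have q1 := sum_rotate_six g3
  have q2 := sum_rotate_six fun a b c d e k => g3 b c d e k a
  have hle : ∑ a, ∑ b, ∑ c, ∑ d, ∑ e, ∑ k, hexWeight f a b c d e k ≤
      ∑ a, ∑ b, ∑ c, ∑ d, ∑ e, ∑ k, (g2 a b c d e k + g2 b c d e k a + g2 c d e k a b +
        g2 d e k a b c + g2 e k a b c d + g2 k a b c d e + g3 a b c d e k + g3 b c d e k a +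
        g3 c d e k a b) := by
    gcongr with a _ b _ c _ d _ e _ k _
    have w0 : 0 ≤ hexWeight f a b c d e k := by
      unfold hexWeight
      have := hf0 a b; have := hf0 b c; have := hf0 c d
      have := hf0 d e; have := hf0 e k; have := hf0 k a
      positivity
    have e1 := hexWeight_rotate f a b c d e k
    have e2 := hexWeight_rotate f b c d e k a
    have e3 := hexWeight_rotate f c d e k a b
    have e4 := hexWeight_rotate f d e k a b c
    have e5 := hexWeight_rotate f e k a b c d
    simp only [g2, g3, e5, e4, e3, e2, e1]
    by_cases h : hexWeight f a b c d e k = 0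
    · simp [h]
    · have := hbad a b c d e k h
      nlinarith
  simp only [Finset.sum_add_distrib] at hle
  simp only [g2, g3] at *
  linarith

/-- The weight of the walks of length three from `u` to `v`. -/
def walkThree (f : V → V → ℝ) (u v : V) : ℝ := ∑ y, f u y * walkTwo f y v

lemma walkThree_symm {f : V → V → ℝ} (hf : ∀ u v, f u v = f v u) (u v : V) :
    walkThree f u v = walkThree f v u := by
  simp only [walkThree, walkTwo, Finset.mul_sum]
  rw [Finset.sum_comm]
  refine Finset.sum_congr rfl fun y _ => Finset.sum_congr rfl fun z _ => ?_
  rw [hf u z, hf z y, hf y v]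
  ring

lemma sum_hexWeight_eq {f : V → V → ℝ} (hf : ∀ u v, f u v = f v u) :
    ∑ a, ∑ b, ∑ c, ∑ d, ∑ e, ∑ k, hexWeight f a b c d e k =
      ∑ u, ∑ v, walkThree f u v ^ 2 := by
  refine Finset.sum_congr rfl fun a _ => ?_
  have hT : ∀ u v, walkThree f u v = ∑ y, ∑ z, f u y * f y z * f z v := fun u v => by
    simp only [walkThree, walkTwo, Finset.mul_sum, mul_assoc]
  have h : ∀ d, walkThree f a d ^ 2 = ∑ b, ∑ c, ∑ e, ∑ k, hexWeight f a b c d e k := by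
    intro d
    rw [pow_two]
    nth_rewrite 1 [walkThree_symm hf]
    simp only [hT, Finset.sum_mul, Finset.mul_sum]
    refine Finset.sum_congr rfl fun b _ => Finset.sum_congr rfl fun c _ =>
      Finset.sum_congr rfl fun e _ => Finset.sum_congr rfl fun k _ => ?_
    unfold hexWeight
    ring
  simp only [h]
  conv_rhs => rw [Finset.sum_comm]
  refine Finset.sum_congr rfl fun b _ => ?_
  conv_rhs => rw [Finset.sum_comm]

lemma sum_mul_apply_comm {f : V → V → ℝ} (hf : ∀ u v, f u v = f v u) (x y : V → ℝ) :
    ∑ u, x u * ∑ v, f u v * y v = ∑ u, (∑ v, f u v * x v) * y u := by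
  simp only [Finset.mul_sum, Finset.sum_mul]
  rw [Finset.sum_comm]
  refine Finset.sum_congr rfl fun u _ => Finset.sum_congr rfl fun v _ => ?_
  rw [hf u v]
  ring

/-- The weighted count of closed walks of length six is large if the quadratic form of `f` is. -/
lemma pow_six_le_sum_hexWeight {f : V → V → ℝ} (hf : ∀ u v, f u v = f v u) (g : V → ℝ)
    {B L : ℝ} (hB : 0 < B) (hL : 0 < L) (hg : ∑ v, g v ^ 2 ≤ B)
    (hLB : L * B ≤ ∑ u, g u * ∑ v, f u v * g v) :
    L ^ 6 ≤ ∑ a, ∑ b, ∑ c, ∑ d, ∑ e, ∑ k, hexWeight f a b c d e k := by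
  rw [sum_hexWeight_eq hf]
  set H := ∑ u, ∑ v, walkThree f u v ^ 2 with hH
  let h1 : V → ℝ := fun u => ∑ v, f u v * g v
  let h2 : V → ℝ := fun u => ∑ v, f u v * h1 v
  let h3 : V → ℝ := fun u => ∑ v, f u v * h2 v
  have c1 : (∑ u, g u * h1 u) ^ 2 ≤ (∑ u, g u ^ 2) * ∑ u, h1 u ^ 2 :=
    Finset.sum_mul_sq_le_sq_mul_sq _ _ _
  have c2 : (∑ u, h1 u ^ 2) ^ 2 ≤ (∑ u, g u ^ 2) * ∑ u, h2 u ^ 2 := by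
    have : ∑ u, h1 u ^ 2 = ∑ u, g u * h2 u := by
      simp only [pow_two]
      exact (sum_mul_apply_comm hf g h1).symm
    rw [this]
    exact Finset.sum_mul_sq_le_sq_mul_sq _ _ _
  have c3 : (∑ u, h2 u ^ 2) ^ 2 ≤ (∑ u, h1 u ^ 2) * ∑ u, h3 u ^ 2 := by
    have : ∑ u, h2 u ^ 2 = ∑ u, h1 u * h3 u := by
      simp only [pow_two]
      exact (sum_mul_apply_comm hf h1 h2).symm
    rw [this]
    exact Finset.sum_mul_sq_le_sq_mul_sq _ _ _
  have h3eq : ∀ u, h3 u = ∑ v, walkThree f u v * g v := by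
    intro u
    simp only [h3, h2, h1, walkThree, walkTwo, Finset.mul_sum, Finset.sum_mul]
    conv_rhs => rw [Finset.sum_comm]
    refine Finset.sum_congr rfl fun y _ => ?_
    conv_rhs => rw [Finset.sum_comm]
    exact Finset.sum_congr rfl fun z _ => Finset.sum_congr rfl fun v _ => by ring
  have c4 : ∑ u, h3 u ^ 2 ≤ H * ∑ u, g u ^ 2 := by
    rw [hH, Finset.sum_mul]
    refine Finset.sum_le_sum fun u _ => ?_
    rw [h3eq]
    exact Finset.sum_mul_sq_le_sq_mul_sq _ _ _
  have hH0 : 0 ≤ H := by positivity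
  have n2 : 0 ≤ ∑ u, h1 u ^ 2 := by positivity
  have n4 : 0 ≤ ∑ u, h2 u ^ 2 := by positivity
  have c0 : L * B ≤ ∑ u, g u * h1 u := hLB
  generalize ∑ u, g u * h1 u = b1 at *
  generalize ∑ u, h1 u ^ 2 = b2 at *
  generalize ∑ u, h2 u ^ 2 = b4 at *
  generalize ∑ u, h3 u ^ 2 = b6 at *
  have d1 : b1 ^ 2 ≤ B * b2 := c1.trans (by gcongr)
  have d2 : b2 ^ 2 ≤ B * b4 := c2.trans (by gcongr)
  have d4 : b6 ≤ H * B := c4.trans (by gcongr)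
  have e2 : L ^ 2 * B ≤ b2 := by
    have : (L * B) ^ 2 ≤ b1 ^ 2 := by gcongr
    have : B * (L ^ 2 * B) ≤ B * b2 := by nlinarith
    exact le_of_mul_le_mul_left this hB
  have p2 : 0 < b2 := lt_of_lt_of_le (by positivity) e2
  have e6 : b2 ^ 3 ≤ B ^ 3 * H := by
    have k1 : b2 * b2 ^ 3 ≤ b2 * (B ^ 3 * H) := by
      calc b2 * b2 ^ 3 = (b2 ^ 2) ^ 2 := by ring
        _ ≤ (B * b4) ^ 2 := by gcongr
        _ = B ^ 2 * b4 ^ 2 := by ring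
        _ ≤ B ^ 2 * (b2 * (H * B)) := by
          gcongr
          exact c3.trans (by gcongr)
        _ = _ := by ring
    exact le_of_mul_le_mul_left k1 p2
  have : B ^ 3 * L ^ 6 ≤ B ^ 3 * H := by
    calc B ^ 3 * L ^ 6 = (L ^ 2 * B) ^ 3 := by ring
      _ ≤ b2 ^ 3 := by gcongr
      _ ≤ _ := e6
  exact le_of_mul_le_mul_left this (by positivity)

/-- Cauchy–Schwarz between closed walks of lengths two, four and six. -/
lemma sq_sum_walkTwo_le {f : V → V → ℝ} (hf : ∀ u v, f u v = f v u) :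
    (∑ u, ∑ v, walkTwo f u v ^ 2) ^ 2 ≤
      (∑ u, ∑ v, f u v ^ 2) * ∑ a, ∑ b, ∑ c, ∑ d, ∑ e, ∑ k, hexWeight f a b c d e k := by
  rw [sum_hexWeight_eq hf]
  have h : ∑ u, ∑ v, walkTwo f u v ^ 2 = ∑ u, ∑ v, f u v * walkThree f u v := by
    refine Finset.sum_congr rfl fun u _ => ?_
    calc ∑ v, walkTwo f u v ^ 2 = ∑ v, ∑ y, f u y * (f v y * walkTwo f v u) := by
          refine Finset.sum_congr rfl fun v _ => ?_
          rw [pow_two]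
          nth_rewrite 2 [walkTwo_symm hf]
          rw [walkTwo, Finset.sum_mul]
          refine Finset.sum_congr rfl fun y _ => ?_
          rw [hf y v]
          ring
      _ = ∑ y, f u y * walkThree f u y := by
          rw [Finset.sum_comm]
          refine Finset.sum_congr rfl fun y _ => ?_
          rw [walkThree_symm hf, walkThree, Finset.mul_sum]
          exact Finset.sum_congr rfl fun v _ => by rw [hf v y]
  rw [h]
  simp only [← Fintype.sum_prod_type']
  exact Finset.sum_mul_sq_le_sq_mul_sq _ _ _

/-- Combining the two bounds between the weights `Q` and `H` of the closed walks of lengths four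
and six. -/
lemma pow_three_le_of_cauchySchwarz {H Q s N δ : ℝ} (hδ : 0 < δ) (hlow : 1 / 64 ≤ H)
    (hup : H ≤ 9 * (s * δ⁻¹) * Q) (hcs : Q ^ 2 ≤ N * δ⁻¹ * H) :
    δ ^ 3 ≤ 5184 * s ^ 2 * N := by
  have hH : 0 < H := lt_of_lt_of_le (by norm_num) hlow
  have hHH : H * H ≤ H * (81 * s ^ 2 * N * δ⁻¹ ^ 3) := by
    calc H * H = H ^ 2 := by ring
      _ ≤ (9 * (s * δ⁻¹) * Q) ^ 2 := by gcongr
      _ = 81 * s ^ 2 * δ⁻¹ ^ 2 * Q ^ 2 := by ring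
      _ ≤ 81 * s ^ 2 * δ⁻¹ ^ 2 * (N * δ⁻¹ * H) := by gcongr
      _ = _ := by ring
  have hfin := hlow.trans (le_of_mul_le_mul_left hHH hH)
  rw [inv_pow, ← div_eq_mul_inv, le_div_iff₀ (by positivity)] at hfin
  linarith

open Classical in
/-- A dense graph contains a closed walk of length six with no two vertices at distance two or
three on the walk related by a relation of bounded degree in neighbourhoods. -/
theorem exists_closedWalk_not_rel [Nonempty V] (Adj r : V → V → Prop)
    (hAdj : ∀ u v, Adj u v → Adj v u) (hr : ∀ u v, r u v → r v u) (s : ℕ) (δ : ℝ) (hδ : 0 < δ)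
    (hs : ∀ u v, #{w | Adj v w ∧ r u w} ≤ s)
    (hdense : δ * Fintype.card V ≤ #{p : V × V | Adj p.1 p.2})
    (hbig : 5184 * (s : ℝ) ^ 2 * Fintype.card V < δ ^ 3) :
    ∃ a b c d e k, (Adj a b ∧ Adj b c ∧ Adj c d ∧ Adj d e ∧ Adj e k ∧ Adj k a) ∧
      (¬ r a c ∧ ¬ r b d ∧ ¬ r c e ∧ ¬ r d k ∧ ¬ r e a ∧ ¬ r k b) ∧
      ¬ r a d ∧ ¬ r b e ∧ ¬ r c k := by
  by_contra hno
  let A : V → V → ℝ := fun u v => if Adj u v then 1 else 0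
  let ρ : V → V → ℝ := fun u v => if r u v then 1 else 0
  have hA0 : ∀ u v, 0 ≤ A u v := fun u v => by simp only [A]; split_ifs <;> norm_num
  have hρ0 : ∀ u v, 0 ≤ ρ u v := fun u v => by simp only [ρ]; split_ifs <;> norm_num
  have hAA : ∀ u v, A u v * A u v = A u v := fun u v => by simp only [A]; split_ifs <;> norm_num
  have hA : ∀ u v, A u v = A v u := fun u v => by
    simp only [A, show Adj u v ↔ Adj v u from ⟨hAdj u v, hAdj v u⟩]
  have hρ : ∀ u v, ρ u v = ρ v u := fun u v => by
    simp only [ρ, show r u v ↔ r v u from ⟨hr u v, hr v u⟩]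
  let deg : V → ℝ := fun u => ∑ v, A u v
  have hdeg0 : ∀ u, 0 ≤ deg u := fun u => Finset.sum_nonneg fun v _ => hA0 u v
  have hdegsum : ∑ u, deg u = #{p : V × V | Adj p.1 p.2} := by
    simp only [deg, A]
    rw [← Fintype.sum_prod_type' (f := fun u v => if Adj u v then (1 : ℝ) else 0),
      Finset.sum_boole]
  let m : V → ℝ := fun u => max δ (deg u)
  have hm : ∀ u, 0 < m u := fun u => lt_max_of_lt_left hδ
  let w : V → ℝ := fun u => (√(m u))⁻¹
  have hw0 : ∀ u, 0 ≤ w u := fun u => by positivity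
  have hw2 : ∀ u, w u ^ 2 = (m u)⁻¹ := fun u => by
    simp only [w, inv_pow, Real.sq_sqrt (hm u).le]
  have hwδ : ∀ u, w u ^ 2 ≤ δ⁻¹ := fun u => by
    rw [hw2]; exact inv_anti₀ hδ (le_max_left _ _)
  have hwκ : ∀ u, w u ≤ (√δ)⁻¹ := fun u => by
    have := Real.sqrt_pos.2 hδ
    exact inv_anti₀ this (Real.sqrt_le_sqrt (le_max_left _ _))
  have hκ : (√δ)⁻¹ * (√δ)⁻¹ = δ⁻¹ := by
    rw [← mul_inv, Real.mul_self_sqrt hδ.le]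
  have hwdeg : ∀ u, w u ^ 2 * deg u ≤ 1 := fun u => by
    rw [hw2, inv_mul_le_iff₀ (hm u), mul_one]; exact le_max_right _ _
  let f : V → V → ℝ := fun u v => A u v * (w u * w v)
  have hf : ∀ u v, f u v = f v u := fun u v => by simp only [f]; rw [hA u v, mul_comm (w u)]
  have hf0 : ∀ u v, 0 ≤ f u v := fun u v =>
    mul_nonneg (hA0 u v) (mul_nonneg (hw0 u) (hw0 v))
  have hfA : ∀ u v, f u v * A u v = f u v := fun u v => by
    simp only [f]; rw [mul_right_comm, hAA]
  have hs' : ∀ u v, ∑ x, A v x * ρ u x ≤ (s : ℝ) := fun u v => by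
    have : ∑ x, A v x * ρ u x = (#{x | Adj v x ∧ r u x} : ℝ) := by
      rw [← Finset.sum_boole]
      refine Finset.sum_congr rfl fun x _ => ?_
      simp only [A, ρ]
      by_cases h1 : Adj v x <;> by_cases h2 : r u x <;> simp [h1, h2]
    rw [this]
    exact_mod_cast hs u v
  have hD : ∀ u, ∑ v, f u v ^ 2 ≤ δ⁻¹ := fun u => by
    calc ∑ v, f u v ^ 2 ≤ ∑ v, w u ^ 2 * A u v * δ⁻¹ := by
          refine Finset.sum_le_sum fun v _ => ?_
          calc f u v ^ 2 = w u ^ 2 * (A u v * A u v) * w v ^ 2 := by simp only [f]; ring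
            _ ≤ w u ^ 2 * A u v * δ⁻¹ := by
              rw [hAA]
              exact mul_le_mul_of_nonneg_left (hwδ v) (mul_nonneg (sq_nonneg _) (hA0 u v))
      _ = w u ^ 2 * deg u * δ⁻¹ := by rw [← Finset.sum_mul, ← Finset.mul_sum]
      _ ≤ 1 * δ⁻¹ := by gcongr; exact hwdeg u
      _ = δ⁻¹ := one_mul _
  have hD' : ∀ u v, f u v * ∑ x, f v x ≤ A u v * δ⁻¹ := fun u v => by
    have h1 : ∑ x, f v x ≤ w v * deg v * (√δ)⁻¹ := by
      simp only [deg, Finset.mul_sum, Finset.sum_mul]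
      refine Finset.sum_le_sum fun x _ => ?_
      calc f v x = w v * A v x * w x := by simp only [f]; ring
        _ ≤ _ := mul_le_mul_of_nonneg_left (hwκ x) (mul_nonneg (hw0 v) (hA0 v x))
    calc f u v * ∑ x, f v x ≤ f u v * (w v * deg v * (√δ)⁻¹) :=
          mul_le_mul_of_nonneg_left h1 (hf0 u v)
      _ = A u v * (w u * (w v ^ 2 * deg v) * (√δ)⁻¹) := by simp only [f]; ring
      _ ≤ A u v * ((√δ)⁻¹ * 1 * (√δ)⁻¹) := by
          refine mul_le_mul_of_nonneg_left ?_ (hA0 u v)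
          have := hwκ u
          have := hwdeg v
          have := mul_nonneg (sq_nonneg (w v)) (hdeg0 v)
          gcongr
      _ = A u v * δ⁻¹ := by rw [mul_one, hκ]
  have hbad : ∀ a b c d e k, hexWeight f a b c d e k ≠ 0 →
      1 ≤ ρ a c + ρ b d + ρ c e + ρ d k + ρ e a + ρ k b + ρ a d + ρ b e + ρ c k := by
    intro a b c d e k hne
    have hadj : ∀ u v, f u v ≠ 0 → Adj u v := fun u v h => by
      by_contra hn
      exact h (by simp [f, A, hn])
    simp only [hexWeight, mul_ne_zero_iff] at hne
    obtain ⟨⟨⟨⟨⟨n1, n2⟩, n3⟩, n4⟩, n5⟩, n6⟩ := hne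
    by_contra hlt
    have hone : ∀ u v, r u v → ρ u v = 1 := fun u v h => by simp [ρ, h]
    have := hρ0 a c; have := hρ0 b d; have := hρ0 c e; have := hρ0 d k; have := hρ0 e a
    have := hρ0 k b; have := hρ0 a d; have := hρ0 b e; have := hρ0 c k
    refine hno ⟨a, b, c, d, e, k, ⟨hadj _ _ n1, hadj _ _ n2, hadj _ _ n3, hadj _ _ n4,
      hadj _ _ n5, hadj _ _ n6⟩, ⟨?_, ?_, ?_, ?_, ?_, ?_⟩, ?_, ?_, ?_⟩ <;>
    · intro h
      have := hone _ _ h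
      exact hlt (by linarith)
  have hδi : 0 < δ⁻¹ := inv_pos.2 hδ
  have hup := sum_hexWeight_le (s := s) (Nat.cast_nonneg s) hδi.le hf hA hρ hf0 hA0 hρ0 hfA hs' hD
    hD' hbad
  have hcs := sq_sum_walkTwo_le hf
  have h2 : ∑ u, ∑ v, f u v ^ 2 ≤ Fintype.card V * δ⁻¹ := by
    calc ∑ u, ∑ v, f u v ^ 2 ≤ ∑ _u : V, δ⁻¹ := Finset.sum_le_sum fun u _ => hD u
      _ = _ := by simp
  rw [← hdegsum] at hdense
  have hsum : 0 < ∑ u, deg u := lt_of_lt_of_le (by positivity) hdense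
  have hlow := pow_six_le_sum_hexWeight hf (fun u => √(m u)) (B := 2 * ∑ u, deg u) (L := 1 / 2)
    (by positivity) (by norm_num)
    (by
      calc ∑ u, √(m u) ^ 2 ≤ ∑ u, (δ + deg u) := by
            refine Finset.sum_le_sum fun u _ => ?_
            rw [Real.sq_sqrt (hm u).le]
            exact max_le (by linarith [hdeg0 u]) (by linarith)
        _ = δ * Fintype.card V + ∑ u, deg u := by
            rw [Finset.sum_add_distrib]; simp [mul_comm]
        _ ≤ _ := by linarith)
    (by
      have hws : ∀ u, w u * √(m u) = 1 := fun u =>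
        inv_mul_cancel₀ (Real.sqrt_pos.2 (hm u)).ne'
      refine le_of_eq ?_
      rw [← mul_assoc]
      norm_num
      refine Finset.sum_congr rfl fun u _ => ?_
      simp only [deg, Finset.mul_sum]
      refine Finset.sum_congr rfl fun v _ => ?_
      calc A u v = A u v * (w u * √(m u)) * (w v * √(m v)) := by rw [hws, hws]; ring
        _ = _ := by simp only [f]; ring)
  exact not_lt_of_ge (pow_three_le_of_cauchySchwarz hδ (by norm_num at hlow ⊢; exact hlow) hup
    (hcs.trans (mul_le_mul_of_nonneg_right h2 (le_trans (by norm_num) hlow))))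
    hbig

end WeightedWalks

section Colorings

variable {n : ℕ} {c : Fin n → Fin n → ℕ}

lemma IsProperEdgeColoring.eq_of_eq (hc : IsProperEdgeColoring n c) {a b b' : Fin n}
    (hb : a ≠ b) (hb' : a ≠ b') (h : c a b = c a b') : b = b' := by
  by_contra hne
  exact hc.2 a b b' hb hb' hne h

lemma exists_isProperEdgeColoring_not_hasRepeat (n : ℕ) :
    ∃ c : Fin n → Fin n → ℕ, IsProperEdgeColoring n c ∧
      ¬ HasRepeat n 2 (SimpleGraph.cycleGraph 6) c := by
  have key : ∀ a b a' b' : Fin n,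
      Nat.pair (min a b : Fin n) (max a b : Fin n) =
          Nat.pair (min a' b' : Fin n) (max a' b' : Fin n) →
        (a = a' ∧ b = b') ∨ (a = b' ∧ b = a') := by
    intro a b a' b' h
    rw [Nat.pair_eq_pair] at h
    simp only [Fin.val_inj] at h
    obtain ⟨h1, h2⟩ := h
    rcases le_total a b with h | h <;> rcases le_total a' b' with h' | h' <;>
      simp_all
  refine ⟨fun a b => Nat.pair (min a b : Fin n) (max a b : Fin n), ⟨?_, ?_⟩, ?_⟩
  · intro a b
    simp only [min_comm, max_comm]
  · intro a b b' hb hb' hne h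
    rcases key _ _ _ _ h with ⟨-, h⟩ | ⟨h, -⟩
    · exact hne h
    · exact hb' h
  · rintro ⟨φ, -, hdisj, hcol⟩
    have h := hcol 0 1 0 1 (by decide)
    rcases key _ _ _ _ h with ⟨h, -⟩ | ⟨h, -⟩
    · exact hdisj 0 1 (by decide) _ _ h
    · exact hdisj 0 1 (by decide) _ _ h

/-- Two pairs of vertices share a vertex. -/
def PairsMeet (p q : Fin n × Fin n) : Prop :=
  p.1 = q.1 ∨ p.2 = q.2 ∨ p.1 = q.2 ∨ p.2 = q.1

/-- Two disjoint pairs of vertices are joined coordinatewise by edges of the same colour. -/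
def PairAdj (c : Fin n → Fin n → ℕ) (p q : Fin n × Fin n) : Prop :=
  p.1 ≠ p.2 ∧ q.1 ≠ q.2 ∧ ¬ PairsMeet p q ∧ c p.1 q.1 = c p.2 q.2

lemma PairAdj.symm (hc : IsProperEdgeColoring n c) {p q : Fin n × Fin n} (h : PairAdj c p q) :
    PairAdj c q p := by
  obtain ⟨h1, h2, h3, h4⟩ := h
  refine ⟨h2, h1, ?_, by rw [hc.1 q.1, hc.1 q.2, h4]⟩
  unfold PairsMeet at *
  tauto

lemma PairAdj.fst_eq_iff (hc : IsProperEdgeColoring n c) {p q q' : Fin n × Fin n}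
    (h : PairAdj c p q) (h' : PairAdj c p q') : q.1 = q'.1 ↔ q.2 = q'.2 := by
  obtain ⟨-, -, h3, h4⟩ := h
  obtain ⟨-, -, h3', h4'⟩ := h'
  simp only [PairsMeet, not_or] at h3 h3'
  constructor
  · intro e
    exact hc.eq_of_eq h3.2.1 h3'.2.1 (by rw [← h4, ← h4', e])
  · intro e
    exact hc.eq_of_eq h3.1 h3'.1 (by rw [h4, h4', e])

open Classical in
lemma card_pairAdj_pairsMeet_le (hc : IsProperEdgeColoring n c) (u v : Fin n × Fin n) :
    #{w | PairAdj c v w ∧ PairsMeet u w} ≤ 4 := by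
  have hfst : ∀ x, #{w | PairAdj c v w ∧ x = w.1} ≤ 1 := fun x => by
    refine Finset.card_le_one.2 fun w hw w' hw' => ?_
    simp only [Finset.mem_filter, Finset.mem_univ, true_and] at hw hw'
    have h := hw.2.symm.trans hw'.2
    exact Prod.ext h ((hw.1.fst_eq_iff hc hw'.1).1 h)
  have hsnd : ∀ x, #{w | PairAdj c v w ∧ x = w.2} ≤ 1 := fun x => by
    refine Finset.card_le_one.2 fun w hw w' hw' => ?_
    simp only [Finset.mem_filter, Finset.mem_univ, true_and] at hw hw'
    have h := hw.2.symm.trans hw'.2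
    exact Prod.ext ((hw.1.fst_eq_iff hc hw'.1).2 h) h
  have hsub : ({w | PairAdj c v w ∧ PairsMeet u w} : Finset (Fin n × Fin n)) ⊆
      (({w | PairAdj c v w ∧ u.1 = w.1} : Finset (Fin n × Fin n)) ∪
        ({w | PairAdj c v w ∧ u.2 = w.2} : Finset (Fin n × Fin n))) ∪
      (({w | PairAdj c v w ∧ u.1 = w.2} : Finset (Fin n × Fin n)) ∪
        ({w | PairAdj c v w ∧ u.2 = w.1} : Finset (Fin n × Fin n))) := by
    intro w
    simp only [Finset.mem_union, Finset.mem_filter, Finset.mem_univ, true_and]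
    unfold PairsMeet
    tauto
  have h1 := hfst u.1
  have h2 := hsnd u.2
  have h3 := hsnd u.1
  have h4 := hfst u.2
  refine (Finset.card_le_card hsub).trans ?_
  refine (Finset.card_union_le _ _).trans ?_
  refine (add_le_add (Finset.card_union_le _ _) (Finset.card_union_le _ _)).trans ?_
  omega

/-- The number of monochromatic ordered pairs of elements is at least `|s|²` divided by the number
of colours. -/
lemma sq_card_le_card_image_mul {α : Type*} [DecidableEq α] (s : Finset α) (g : α → ℕ) :
    #s ^ 2 ≤ #(s.image g) * #{p ∈ s ×ˢ s | g p.1 = g p.2} := by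
  have h1 : #s = ∑ i ∈ s.image g, #{a ∈ s | g a = i} := Finset.card_eq_sum_card_image g s
  have h2 : #{p ∈ s ×ˢ s | g p.1 = g p.2} = ∑ i ∈ s.image g, #{a ∈ s | g a = i} ^ 2 := by
    rw [Finset.card_filter, Finset.sum_product]
    calc ∑ x ∈ s, ∑ y ∈ s, (if g x = g y then 1 else 0)
        = ∑ x ∈ s, #{a ∈ s | g a = g x} := by
          refine Finset.sum_congr rfl fun x _ => ?_
          rw [Finset.card_filter]
          exact Finset.sum_congr rfl fun y _ => by simp only [eq_comm]
      _ = _ := by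
          rw [Finset.sum_comp (fun i => #{a ∈ s | g a = i}) g]
          exact Finset.sum_congr rfl fun i _ => by rw [smul_eq_mul, pow_two]
  rw [h2]
  nth_rewrite 1 [h1]
  exact sq_sum_le_card_mul_sum_sq

open Classical in
lemma card_monochromatic_le (hc : IsProperEdgeColoring n c)
    (E : Finset (Fin n × Fin n)) (hE : ∀ p ∈ E, p.1 ≠ p.2) :
    #{p ∈ E ×ˢ E | c p.1.1 p.1.2 = c p.2.1 p.2.2} ≤
      #{p : (Fin n × Fin n) × (Fin n × Fin n) | PairAdj c p.1 p.2} + 2 * #E := by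
  set T : Finset ((Fin n × Fin n) × (Fin n × Fin n)) :=
    {p | PairAdj c p.1 p.2} with hT
  have hsub : {p ∈ E ×ˢ E | c p.1.1 p.1.2 = c p.2.1 p.2.2} ⊆
      T.image (fun p => ((p.1.1, p.2.1), (p.1.2, p.2.2))) ∪
        (E.image (fun e => (e, e)) ∪ E.image fun e => (e, e.swap)) := by
    rintro ⟨⟨x, x'⟩, ⟨y, y'⟩⟩ hp
    simp only [Finset.mem_filter, Finset.mem_product] at hp
    obtain ⟨⟨hx, hy⟩, hcol⟩ := hp
    have nx : x ≠ x' := hE _ hx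
    have ny : y ≠ y' := hE _ hy
    simp only [Finset.mem_union, Finset.mem_image]
    by_cases e1 : x = y
    · subst e1
      have := hc.eq_of_eq nx ny hcol
      subst this
      exact Or.inr (Or.inl ⟨_, hx, rfl⟩)
    by_cases e2 : x' = y'
    · subst e2
      rw [hc.1 x, hc.1 y] at hcol
      exact absurd (hc.eq_of_eq nx.symm ny.symm hcol) e1
    by_cases e3 : x = y'
    · subst e3
      rw [hc.1 y] at hcol
      have := hc.eq_of_eq nx ny.symm hcol
      subst this
      exact Or.inr (Or.inr ⟨_, hx, rfl⟩)
    by_cases e4 : y = x'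
    · subst e4
      rw [hc.1 x] at hcol
      exact absurd (hc.eq_of_eq nx.symm ny hcol) e3
    refine Or.inl ⟨((x, y), (x', y')), ?_, rfl⟩
    simp only [hT, Finset.mem_filter, Finset.mem_univ, true_and]
    unfold PairAdj PairsMeet
    tauto
  have h1 := Finset.card_le_card hsub
  have h2 := Finset.card_union_le (T.image fun p => ((p.1.1, p.2.1), (p.1.2, p.2.2)))
    (E.image (fun e => (e, e)) ∪ E.image fun e => (e, e.swap))
  have h3 := Finset.card_union_le (E.image fun e => (e, e)) (E.image fun e => (e, e.swap))
  have h4 : #(T.image fun p => ((p.1.1, p.2.1), (p.1.2, p.2.2))) ≤ #T := Finset.card_image_le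
  have h5 : #(E.image fun e => (e, e)) ≤ #E := Finset.card_image_le
  have h6 : #(E.image fun e => (e, e.swap)) ≤ #E := Finset.card_image_le
  omega

/-- A hexagon of pairwise disjoint pairs yields two colour-isomorphic disjoint six-cycles. -/
lemma hasRepeat_of_pairAdj (hc : IsProperEdgeColoring n c) {p : Fin 6 → Fin n × Fin n}
    (hadj : ∀ i, PairAdj c (p i) (p (i + 1)))
    (hmeet : ∀ i j, i ≠ j → ¬ PairsMeet (p i) (p j)) :
    HasRepeat n 2 (SimpleGraph.cycleGraph 6) c := by
  simp only [PairsMeet, not_or] at hmeet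
  have hcol : ∀ u v, (SimpleGraph.cycleGraph 6).Adj u v →
      c (p u).1 (p v).1 = c (p u).2 (p v).2 := by
    intro u v h
    rw [SimpleGraph.cycleGraph_adj] at h
    rcases h with h | h
    · obtain rfl : u = v + 1 := by rw [← h]; abel
      have := (hadj v).2.2.2
      rwa [hc.1 (p v).1, hc.1 (p v).2] at this
    · obtain rfl : v = u + 1 := by rw [← h]; abel
      exact (hadj u).2.2.2
  have hne : ∀ u v, (p u).1 ≠ (p v).2 := by
    intro u v
    by_cases h : u = v
    · subst h; exact (hadj u).1
    · exact (hmeet u v h).2.2.1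
  refine ⟨![fun i => (p i).1, fun i => (p i).2], ?_, ?_, ?_⟩
  · intro i u v h
    by_contra huv
    fin_cases i
    · exact (hmeet u v huv).1 h
    · exact (hmeet u v huv).2.1 h
  · intro i j hij u v
    fin_cases i <;> fin_cases j
    · exact absurd rfl hij
    · exact hne u v
    · exact (hne v u).symm
    · exact absurd rfl hij
  · intro i j u v h
    have := hcol u v h
    fin_cases i <;> fin_cases j
    · rfl
    · exact this
    · exact this.symm
    · rfl

/-- The vertices of a hexagon are pairwise unrelated if they are so at distances one, two, three. -/
lemma not_rel_of_hexagon {α : Type*} {R : α → α → Prop} (hR : ∀ u v, R u v → R v u)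
    {a b c d e k : α} (m₁ : ¬ R a b) (m₂ : ¬ R b c) (m₃ : ¬ R c d) (m₄ : ¬ R d e) (m₅ : ¬ R e k)
    (m₆ : ¬ R k a) (r₁ : ¬ R a c) (r₂ : ¬ R b d) (r₃ : ¬ R c e) (r₄ : ¬ R d k) (r₅ : ¬ R e a)
    (r₆ : ¬ R k b) (t₁ : ¬ R a d) (t₂ : ¬ R b e) (t₃ : ¬ R c k) (i j : Fin 6) (hij : i ≠ j) :
    ¬ R (![a, b, c, d, e, k] i) (![a, b, c, d, e, k] j) := by
  fin_cases i <;> fin_cases j <;>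
    first
    | exact absurd rfl hij
    | assumption
    | (refine mt (hR _ _) ?_; assumption)

/-- A proper edge colouring without repeated six-cycles uses at least `n ^ (4 / 3) / 400` colours. -/
lemma le_cube_numColors (hn : 2 ≤ n) (hc : IsProperEdgeColoring n c)
    (hrep : ¬ HasRepeat n 2 (SimpleGraph.cycleGraph 6) c) :
    (1 / 400 : ℝ) ^ 3 * (n : ℝ) ^ 4 ≤ (numColors n c : ℝ) ^ 3 := by
  classical
  by_contra hlt
  push Not at hlt
  set E : Finset (Fin n × Fin n) := {p | p.1 ≠ p.2} with hE
  have hEcard : #E = n * n - n := by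
    have : E = (Finset.univ : Finset (Fin n)).offDiag := by
      ext p
      simp [hE, Finset.mem_offDiag]
    rw [this, Finset.offDiag_card, Finset.card_univ, Fintype.card_fin]
  have h1 := sq_card_le_card_image_mul E fun p => c p.1 p.2
  have h2 := card_monochromatic_le hc E (by simp [hE])
  have hC : numColors n c = #(E.image fun p => c p.1 p.2) := rfl
  rw [← hC] at h1
  set T := #{p : (Fin n × Fin n) × (Fin n × Fin n) | PairAdj c p.1 p.2} with hT
  set C := numColors n c
  have hn' : (2 : ℝ) ≤ n := by exact_mod_cast hn
  have hEr : (#E : ℝ) = n * n - n := by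
    rw [hEcard, Nat.cast_sub (Nat.le_mul_self n)]; push_cast; rfl
  have hElow : (n : ℝ) ^ 2 / 2 ≤ #E := by rw [hEr]; nlinarith
  have hEup : (#E : ℝ) ≤ (n : ℝ) ^ 2 := by rw [hEr]; nlinarith
  have hprod : (#E : ℝ) ^ 2 ≤ C * (T + 2 * #E) := by
    exact_mod_cast h1.trans (Nat.mul_le_mul_left _ h2)
  have hCpos : (0 : ℝ) < C := by
    rcases (Nat.cast_nonneg (α := ℝ) C).eq_or_lt with h | h
    · rw [← h] at hprod
      nlinarith
    · exact h
  have hCsmall : 16 * (C : ℝ) ≤ (n : ℝ) ^ 2 := by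
    refine le_of_pow_le_pow_left₀ (n := 3) (by norm_num) (by positivity) ?_
    have : (n : ℝ) ^ 4 ≤ (n : ℝ) ^ 6 := pow_le_pow_right₀ (by linarith) (by norm_num)
    calc (16 * (C : ℝ)) ^ 3 = 4096 * (C : ℝ) ^ 3 := by ring
      _ ≤ 4096 * ((1 / 400 : ℝ) ^ 3 * (n : ℝ) ^ 4) := by gcongr
      _ ≤ (n : ℝ) ^ 6 := by
        have : (0 : ℝ) ≤ (n : ℝ) ^ 4 := by positivity
        linarith
      _ = _ := by ring
  have hTlow : (n : ℝ) ^ 2 / (8 * C) * (n : ℝ) ^ 2 ≤ T := by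
    rw [div_mul_eq_mul_div, div_le_iff₀ (by positivity)]
    have k1 : ((n : ℝ) ^ 2 / 2) ^ 2 ≤ (#E : ℝ) ^ 2 := by gcongr
    have k2 : (C : ℝ) * #E ≤ C * (n : ℝ) ^ 2 := by gcongr
    have k3 : 16 * (C : ℝ) * (n : ℝ) ^ 2 ≤ (n : ℝ) ^ 2 * (n : ℝ) ^ 2 := by gcongr
    nlinarith
  have : Nonempty (Fin n × Fin n) := ⟨(⟨0, by omega⟩, ⟨0, by omega⟩)⟩
  have hcard : (Fintype.card (Fin n × Fin n) : ℝ) = (n : ℝ) ^ 2 := by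
    simp [pow_two]
  have hsymm : ∀ p q : Fin n × Fin n, PairsMeet p q → PairsMeet q p := by
    intro p q h
    unfold PairsMeet at *
    tauto
  obtain ⟨a, b, x, d, e, k, ⟨w1, w2, w3, w4, w5, w6⟩, ⟨r1, r2, r3, r4, r5, r6⟩, t1, t2, t3⟩ :=
    exists_closedWalk_not_rel (PairAdj c) PairsMeet (fun _ _ h => h.symm hc)
      hsymm 4 ((n : ℝ) ^ 2 / (8 * C)) (by positivity)
      (card_pairAdj_pairsMeet_le hc) (by rw [hcard]; exact hTlow)
      (by
        rw [hcard, div_pow, lt_div_iff₀ (by positivity)]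
        have : 0 < (n : ℝ) ^ 2 := by positivity
        have : 42467328 * (C : ℝ) ^ 3 < (n : ℝ) ^ 4 := by
          have : 0 < (n : ℝ) ^ 4 := by positivity
          linarith
        calc 5184 * ((4 : ℕ) : ℝ) ^ 2 * (n : ℝ) ^ 2 * (8 * (C : ℝ)) ^ 3
            = (n : ℝ) ^ 2 * (42467328 * (C : ℝ) ^ 3) := by push_cast; ring
          _ < (n : ℝ) ^ 2 * (n : ℝ) ^ 4 := by gcongr
          _ = _ := by ring)
  refine hrep (hasRepeat_of_pairAdj hc (p := ![a, b, x, d, e, k]) ?_ ?_)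
  · intro i
    fin_cases i
    exacts [w1, w2, w3, w4, w5, w6]
  · exact not_rel_of_hexagon hsymm w1.2.2.1 w2.2.2.1 w3.2.2.1 w4.2.2.1 w5.2.2.1 w6.2.2.1
      r1 r2 r3 r4 r5 r6 t1 t2 t3

end Colorings

/-- `f₂(n, C₆) = Ω(n^{4/3})`. -/
theorem stmt_18 :
    ∃ c : ℝ, 0 < c ∧ ∃ n₀ : ℕ, ∀ n ≥ n₀,
      c * (n : ℝ) ^ ((4 : ℝ) / 3) ≤ (repeatNumber 2 n (SimpleGraph.cycleGraph 6) : ℝ) := by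
  refine ⟨1 / 400, by norm_num, 2, fun n hn => ?_⟩
  obtain ⟨c₀, hc₀, hr₀⟩ := exists_isProperEdgeColoring_not_hasRepeat n
  obtain ⟨c, hc, hnum, hrep⟩ : repeatNumber 2 n (SimpleGraph.cycleGraph 6) ∈
      { C | ∃ c : Fin n → Fin n → ℕ, IsProperEdgeColoring n c ∧ numColors n c = C ∧
        ¬ HasRepeat n 2 (SimpleGraph.cycleGraph 6) c } :=
    Nat.sInf_mem ⟨_, c₀, hc₀, rfl, hr₀⟩
  rw [← hnum]
  refine le_of_pow_le_pow_left₀ (n := 3) (by norm_num) (by positivity) ?_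
  have hpow : ((n : ℝ) ^ ((4 : ℝ) / 3)) ^ 3 = (n : ℝ) ^ 4 := by
    rw [← Real.rpow_natCast, ← Real.rpow_mul (Nat.cast_nonneg n), ← Real.rpow_natCast]
    norm_num
  rw [mul_pow, hpow]
  exact le_cube_numColors hn hc hrep
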